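/- arXiv:2311.07412 — 7 statements merged into one kernel-verified Lean document; each statement's English description precedes it below -/
import Mathlib

section
/- Let n ≥ 1 and k be integers with 1 ≤ k ≤ n+1 and k > n/2 + 1. Then for the block matrix μ = [[0, −B u*], [u B, D]] one has (μ H^{n-1}_{k-1}(μ))₋₋ u = 0; in particular the right-hand side i^{n+1}(μ H^{n-1}_{k-1}(μ))₋₋ u of the evolution equation ∂u/∂t^n_k = i^{n+1}(μ H^{n-1}_{k-1}(μ))₋₋ u vanishes. -/
open Matrix Complex
open scoped ComplexOrder

/-- `H^n_k(X) = Σ P^{i₀} X P^{i₁} X ⋯ X P^{iₙ}`, sum over `(i₀,…,iₙ) ∈ {0,1}^{n+1}`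
with `i₀+⋯+iₙ = k`. -/
noncomputable def Hpoly {ι : Type*} [Fintype ι] [DecidableEq ι]
    (P X : Matrix ι ι ℂ) (n k : ℕ) : Matrix ι ι ℂ :=
  ∑ c ∈ Finset.univ.filter (fun c : Fin (n + 1) → Fin 2 => (∑ j, (c j : ℕ)) = k),
    (List.ofFn fun j : Fin n => P ^ (c j.castSucc : ℕ) * X).prod * P ^ (c (Fin.last n) : ℕ)

/-- The projector onto the first (`+`) summand. -/
noncomputable def Pplus (N M : ℕ) : Matrix (Fin N ⊕ Fin M) (Fin N ⊕ Fin M) ℂ :=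
  Matrix.fromBlocks 1 0 0 0

/-- The block matrix `μ = [[0, −B u*], [u B, D]]`. -/
noncomputable def muBlock {N M : ℕ} (u : Matrix (Fin M) (Fin N) ℂ)
    (B : Matrix (Fin N) (Fin N) ℂ) (D : Matrix (Fin M) (Fin M) ℂ) :
    Matrix (Fin N ⊕ Fin M) (Fin N ⊕ Fin M) ℂ :=
  Matrix.fromBlocks 0 (-(B * uᴴ)) (u * B) D


/-- If `P X P = 0`, then a word `P^{c₀} X P^{c₁} ⋯ X P^{cₙ}` in which more than half of the letters
`P` occur ends in `P`, and it vanishes as soon as two letters `P` must be adjacent. -/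
theorem prod_ofFn_pow_mul_idempotent {R : Type*} [Semiring R] {P X : R}
    (hP : P * P = P) (hX : P * X * P = 0) (n : ℕ) (c : Fin (n + 1) → Fin 2) :
    (n + 1 < 2 * ∑ j, (c j : ℕ) →
      (List.ofFn fun j : Fin n => P ^ (c j.castSucc : ℕ) * X).prod * P ^ (c (Fin.last n) : ℕ) * P =
        (List.ofFn fun j : Fin n => P ^ (c j.castSucc : ℕ) * X).prod *
          P ^ (c (Fin.last n) : ℕ)) ∧
    (n + 2 < 2 * ∑ j, (c j : ℕ) →
      (List.ofFn fun j : Fin n => P ^ (c j.castSucc : ℕ) * X).prod * P ^ (c (Fin.last n) : ℕ) =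
        0) := by
  induction n with
  | zero =>
    have hlast : c (Fin.last 0) = c 0 := rfl
    simp only [Fin.sum_univ_succ, Finset.univ_eq_empty, Finset.sum_empty, List.ofFn_zero,
      List.prod_nil, one_mul, hlast]
    refine ⟨fun h => ?_, fun h => by omega⟩
    have hc : (c 0 : ℕ) = 1 := by omega
    rw [hc, pow_one, hP]
  | succ n ih =>
    obtain ⟨ih₁, ih₂⟩ := ih fun j => c j.castSucc
    have hword : (List.ofFn fun j : Fin (n + 1) => P ^ (c j.castSucc : ℕ) * X).prod =
        (List.ofFn fun j : Fin n => P ^ (c j.castSucc.castSucc : ℕ) * X).prod *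
          P ^ (c (Fin.last n).castSucc : ℕ) * X := by
      rw [List.ofFn_succ', List.concat_eq_append, List.prod_append, List.prod_singleton, mul_assoc]
    rw [Fin.sum_univ_castSucc, hword]
    generalize (List.ofFn fun j : Fin n => P ^ (c j.castSucc.castSucc : ℕ) * X).prod *
      P ^ (c (Fin.last n).castSucc : ℕ) = T at ih₁ ih₂ ⊢
    obtain hc | hc : (c (Fin.last (n + 1)) : ℕ) = 0 ∨ (c (Fin.last (n + 1)) : ℕ) = 1 := by omega
    · rw [hc]
      refine ⟨fun h => ?_, fun h => ?_⟩ <;> simp [ih₂ (by omega)]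
    · rw [hc, pow_one]
      refine ⟨fun _ => by rw [mul_assoc, hP], fun h => ?_⟩
      rw [← ih₁ (by omega), mul_assoc T, mul_assoc T, hX, mul_zero]

/-- If `P X P = 0`, then `H^n_k(X)` ends in `P` for `2k > n + 1`. -/
theorem Hpoly_mul_idempotent {ι : Type*} [Fintype ι] [DecidableEq ι] {P X : Matrix ι ι ℂ}
    (hP : P * P = P) (hX : P * X * P = 0) {n k : ℕ} (h : n + 1 < 2 * k) :
    Hpoly P X n k * P = Hpoly P X n k := by
  rw [Hpoly, Finset.sum_mul]
  refine Finset.sum_congr rfl fun c hc => (prod_ofFn_pow_mul_idempotent hP hX n c).1 ?_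
  rwa [(Finset.mem_filter.mp hc).2]

/-- Right multiplication by the projector onto the first summand kills the lower right block. -/
theorem toBlocks₂₂_mul_Pplus {N M : ℕ} (A : Matrix (Fin N ⊕ Fin M) (Fin N ⊕ Fin M) ℂ) :
    (A * Pplus N M).toBlocks₂₂ = 0 := by
  rw [← fromBlocks_toBlocks A, Pplus, fromBlocks_multiply, toBlocks_fromBlocks₂₂]
  simp

/-- for `n ≥ 1`, `1 ≤ k ≤ n+1` and `k > n/2 + 1`, the right-hand side
`i^{n+1} (μ H^{n-1}_{k-1}(μ))₋₋ u` of the evolution equation vanishes. -/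
theorem stmt_0 (N M : ℕ) (hN : 0 < N) (hM : 0 < M)
    (u : Matrix (Fin M) (Fin N) ℂ) (hu : u * uᴴ * u = u)
    (B : Matrix (Fin N) (Fin N) ℂ) (hB : B.PosSemidef) (hBu : B * (uᴴ * u) = B)
    (D : Matrix (Fin M) (Fin M) ℂ) (hD : Dᴴ = -D)
    (n k : ℕ) (hn : 1 ≤ n) (hk1 : 1 ≤ k) (hk2 : k ≤ n + 1)
    (hbig : (n : ℝ) / 2 + 1 < (k : ℝ)) :
    (muBlock u B D * Hpoly (Pplus N M) (muBlock u B D) (n - 1) (k - 1)).toBlocks₂₂ * u = 0 ∧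
    Complex.I ^ (n + 1) •
      ((muBlock u B D * Hpoly (Pplus N M) (muBlock u B D) (n - 1) (k - 1)).toBlocks₂₂ * u)
      = 0 := by
  have hP : Pplus N M * Pplus N M = Pplus N M := by simp [Pplus, fromBlocks_multiply]
  have hX : Pplus N M * muBlock u B D * Pplus N M = 0 := by
    simp [Pplus, muBlock, fromBlocks_multiply]
  have hnk : n + 2 < 2 * k := by
    have h : (n : ℝ) + 2 < 2 * k := by linarith
    exact_mod_cast h
  have key : (muBlock u B D *
      Hpoly (Pplus N M) (muBlock u B D) (n - 1) (k - 1)).toBlocks₂₂ * u = 0 := by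
    rw [← Hpoly_mul_idempotent hP hX (by omega), ← mul_assoc, toBlocks₂₂_mul_Pplus,
      Matrix.zero_mul]
  exact ⟨key, by rw [key, smul_zero]⟩
end

section
/- Fix n ≥ 1 and 1 ≤ k ≤ n+1. Let μ : ℝ → Mat_{(N+M)×(N+M)}(ℂ) be differentiable with μ(t) skew-Hermitian for all t and satisfying the Lax equation μ′(t) = i^{n+1} [μ(t), H^n_k(μ(t))]. Then the diagonal blocks are constant: P₊ μ(t) P₊ = P₊ μ(0) P₊ and P₋ μ(t) P₋ = P₋ μ(0) P₋ for all t. -/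
open Matrix Complex
open scoped ComplexOrder

section Hpoly

variable {ι : Type*} [Fintype ι] [DecidableEq ι] (P X : Matrix ι ι ℂ)

theorem Hpoly_eq_sum_ite (n k : ℕ) :
    Hpoly P X n k = ∑ c : Fin (n + 1) → Fin 2, if (∑ j, (c j : ℕ)) = k then
      (List.ofFn fun j : Fin n => P ^ (c j.castSucc : ℕ) * X).prod * P ^ (c (Fin.last n) : ℕ)
      else 0 := by
  rw [Hpoly, Finset.sum_filter]

theorem Hpoly_zero (k : ℕ) :
    Hpoly P X 0 k = if k = 0 then 1 else if k = 1 then P else 0 := by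
  rw [Hpoly_eq_sum_ite, ← (Equiv.funUnique (Fin 1) (Fin 2)).symm.sum_comp]
  rcases k with _ | _ | k <;> simp

theorem Hpoly_succ_eq_sum (n k : ℕ) :
    Hpoly P X (n + 1) k = ∑ a : Fin 2, ∑ c : Fin (n + 1) → Fin 2,
      if (a : ℕ) + (∑ j, (c j : ℕ)) = k then
        P ^ (a : ℕ) * X * ((List.ofFn fun j : Fin n => P ^ (c j.castSucc : ℕ) * X).prod *
          P ^ (c (Fin.last n) : ℕ))
      else 0 := by
  rw [Hpoly_eq_sum_ite, ← (Fin.consEquiv fun _ : Fin (n + 2) => Fin 2).sum_comp,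
    Fintype.sum_prod_type]
  refine Finset.sum_congr rfl fun a _ => Finset.sum_congr rfl fun c _ => ?_
  simp [Fin.consEquiv, Fin.sum_univ_succ, List.ofFn_succ, ← Fin.succ_last, mul_assoc]

theorem Hpoly_succ_zero (n : ℕ) : Hpoly P X (n + 1) 0 = X * Hpoly P X n 0 := by
  rw [Hpoly_succ_eq_sum, Fin.sum_univ_two, Hpoly_eq_sum_ite, Finset.mul_sum]
  simp

theorem Hpoly_succ_succ (n k : ℕ) :
    Hpoly P X (n + 1) (k + 1) = X * Hpoly P X n (k + 1) + P * X * Hpoly P X n k := by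
  rw [Hpoly_succ_eq_sum, Fin.sum_univ_two, Hpoly_eq_sum_ite, Hpoly_eq_sum_ite, Finset.mul_sum,
    Finset.mul_sum]
  simp [add_comm 1]

theorem commute_Hpoly_zero (n : ℕ) : X * Hpoly P X n 0 = Hpoly P X n 0 * X := by
  induction n with
  | zero => simp [Hpoly_zero]
  | succ n ih => rw [Hpoly_succ_zero, mul_assoc, ← ih]

theorem mul_Hpoly_add_eq (n k : ℕ) :
    X * Hpoly P X n (k + 1) + P * X * Hpoly P X n k =
      Hpoly P X n (k + 1) * X + Hpoly P X n k * X * P := by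
  induction n generalizing k with
  | zero => rcases k with _ | _ | k <;> simp [Hpoly_zero, add_comm]
  | succ n ih =>
    have h : Hpoly P X (n + 1) (k + 1) = Hpoly P X n (k + 1) * X + Hpoly P X n k * X * P := by
      rw [Hpoly_succ_succ, ih]
    rcases k with _ | k
    · nth_rw 1 [h]
      rw [Hpoly_succ_succ, Hpoly_succ_zero]
      rw [show P * X * (X * Hpoly P X n 0) = P * X * (Hpoly P X n 0 * X) by
        rw [commute_Hpoly_zero]]
      noncomm_ring
    · have h' : Hpoly P X (n + 1) (k + 1) = Hpoly P X n (k + 1) * X + Hpoly P X n k * X * P := by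
        rw [Hpoly_succ_succ, ih]
      nth_rw 1 [h]
      nth_rw 1 [h']
      rw [Hpoly_succ_succ, Hpoly_succ_succ]
      noncomm_ring

theorem commutator_Hpoly_succ (n k : ℕ) :
    X * Hpoly P X n (k + 1) - Hpoly P X n (k + 1) * X =
      Hpoly P X n k * X * P - P * X * Hpoly P X n k := by
  rw [sub_eq_sub_iff_add_eq_add, mul_Hpoly_add_eq, add_comm]

variable {P}

theorem compl_mul_commutator_Hpoly_mul_compl (hP : P * P = P) (n k : ℕ) :
    (1 - P) * (X * Hpoly P X n k - Hpoly P X n k * X) * (1 - P) = 0 := by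
  rcases k with _ | k
  · simp [commute_Hpoly_zero]
  · have hl : (1 - P) * P = 0 := by rw [sub_mul, one_mul, hP, sub_self]
    have hr : P * (1 - P) = 0 := by rw [mul_sub, mul_one, hP, sub_self]
    calc (1 - P) * (X * Hpoly P X n (k + 1) - Hpoly P X n (k + 1) * X) * (1 - P)
        = (1 - P) * Hpoly P X n k * X * (P * (1 - P)) -
            ((1 - P) * P) * X * Hpoly P X n k * (1 - P) := by
          rw [commutator_Hpoly_succ]; noncomm_ring
      _ = 0 := by rw [hl, hr]; simp

theorem mul_commutator_Hpoly_mul (hP : P * P = P) (n k : ℕ) :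
    P * (X * Hpoly P X n k - Hpoly P X n k * X) * P = 0 := by
  induction k with
  | zero => simp [commute_Hpoly_zero]
  | succ k ih =>
    calc P * (X * Hpoly P X n (k + 1) - Hpoly P X n (k + 1) * X) * P
        = P * Hpoly P X n k * X * (P * P) - (P * P) * X * Hpoly P X n k * P := by
          rw [commutator_Hpoly_succ]; noncomm_ring
      _ = -(P * (X * Hpoly P X n k - Hpoly P X n k * X) * P) := by
          rw [hP]; noncomm_ring
      _ = 0 := by rw [ih, neg_zero]

end Hpoly

theorem Pplus_mul_self (N M : ℕ) : Pplus N M * Pplus N M = Pplus N M := by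
  simp [Pplus, fromBlocks_multiply]

theorem one_sub_Pplus (N M : ℕ) : 1 - Pplus N M = fromBlocks 0 0 0 1 := by
  rw [sub_eq_iff_eq_add, Pplus, fromBlocks_add]
  simp

theorem Pplus_mul_mul_Pplus {N M : ℕ} (A : Matrix (Fin N ⊕ Fin M) (Fin N ⊕ Fin M) ℂ) :
    Pplus N M * A * Pplus N M = fromBlocks A.toBlocks₁₁ 0 0 0 := by
  conv_lhs => rw [← fromBlocks_toBlocks A]
  simp [Pplus, fromBlocks_multiply]

theorem compl_Pplus_mul_mul_compl_Pplus {N M : ℕ}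
    (A : Matrix (Fin N ⊕ Fin M) (Fin N ⊕ Fin M) ℂ) :
    (1 - Pplus N M) * A * (1 - Pplus N M) = fromBlocks 0 0 0 A.toBlocks₂₂ := by
  conv_lhs => rw [← fromBlocks_toBlocks A]
  simp [one_sub_Pplus, fromBlocks_multiply]

/-- along the Lax equation `μ′ = i^{n+1} [μ, H^n_k(μ)]` the diagonal blocks
`P₊ μ P₊` and `P₋ μ P₋` are constant. -/
theorem stmt_7 (N M : ℕ) (hN : 0 < N) (hM : 0 < M)
    (n k : ℕ) (hn : 1 ≤ n) (hk1 : 1 ≤ k) (hk2 : k ≤ n + 1)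
    (μ : ℝ → Matrix (Fin N ⊕ Fin M) (Fin N ⊕ Fin M) ℂ)
    (hskew : ∀ t, (μ t)ᴴ = -μ t)
    (hlax : ∀ (t : ℝ) (p q : Fin N ⊕ Fin M),
      HasDerivAt (fun s => μ s p q)
        ((Complex.I ^ (n + 1) •
          (μ t * Hpoly (Pplus N M) (μ t) n k - Hpoly (Pplus N M) (μ t) n k * μ t)) p q) t) :
    ∀ t, Pplus N M * μ t * Pplus N M = Pplus N M * μ 0 * Pplus N M ∧
      (1 - Pplus N M) * μ t * (1 - Pplus N M) = (1 - Pplus N M) * μ 0 * (1 - Pplus N M) := by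
  have const : ∀ p q, (∀ t, (μ t * Hpoly (Pplus N M) (μ t) n k -
      Hpoly (Pplus N M) (μ t) n k * μ t) p q = 0) → ∀ t, μ t p q = μ 0 p q := by
    intro p q h t
    refine is_const_of_deriv_eq_zero (f := fun s => μ s p q)
      (fun s => (hlax s p q).differentiableAt) (fun s => ?_) t 0
    rw [(hlax s p q).deriv, Matrix.smul_apply, h s, smul_zero]
  intro t
  rw [Pplus_mul_mul_Pplus, Pplus_mul_mul_Pplus, compl_Pplus_mul_mul_compl_Pplus,
    compl_Pplus_mul_mul_compl_Pplus]
  constructor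
  · congr 1
    ext i j
    refine const _ _ (fun s => ?_) t
    have h := mul_commutator_Hpoly_mul (μ s) (Pplus_mul_self N M) n k
    rw [Pplus_mul_mul_Pplus] at h
    exact congrFun (congrFun h (Sum.inl i)) (Sum.inl j)
  · congr 1
    ext i j
    refine const _ _ (fun s => ?_) t
    have h := compl_mul_commutator_Hpoly_mul_compl (μ s) (Pplus_mul_self N M) n k
    rw [compl_Pplus_mul_mul_compl_Pplus] at h
    exact congrFun (congrFun h (Sum.inr i)) (Sum.inr j)
end

section
/- Fix n ≥ 1 and 1 ≤ k ≤ n+1. Let μ : ℝ → Mat_{(N+M)×(N+M)}(ℂ) be differentiable with μ(t) skew-Hermitian for all t and satisfying the Lax equation μ′(t) = i^{n+1} [μ(t), H^n_k(μ(t))]. Then for every m ≥ 1 and every 0 ≤ l ≤ m+1, the trace Tr H^m_l(μ(t)) is constant in t; i.e. the traces of all the operators H^m_l are integrals of motion of the whole hierarchy. -/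
open Matrix Complex
open scoped ComplexOrder

open Finset in
/-- A polynomial function that vanishes off one point has vanishing coefficients. -/
lemma eq_zero_of_sum_pow_mul_eq_zero (d : ℕ) (a : ℕ → ℂ) (z₀ : ℂ)
    (h : ∀ z, z ≠ z₀ → ∑ k ∈ range d, z ^ k * a k = 0) {k : ℕ} (hk : k < d) : a k = 0 := by
  have hp : (∑ k ∈ range d, Polynomial.monomial k (a k) : Polynomial ℂ) = 0 := by
    refine Polynomial.eq_zero_of_infinite_isRoot _
      (Set.Infinite.mono (s := {z₀}ᶜ) (fun z hz => ?_) (Set.finite_singleton z₀).infinite_compl)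
    simpa [Polynomial.IsRoot, Polynomial.eval_finsetSum, mul_comm] using h z hz
  simpa [Polynomial.finsetSum_coeff, Polynomial.coeff_monomial, hk] using
    congrArg (Polynomial.coeff · k) hp

lemma matrix_lie_sum {ι κ : Type*} [Fintype ι] (A : Matrix ι ι ℂ) (s : Finset κ)
    (f : κ → Matrix ι ι ℂ) :
    ⁅A, ∑ i ∈ s, f i⁆ = ∑ i ∈ s, ⁅A, f i⁆ := by
  simp only [Ring.lie_def, Finset.mul_sum, Finset.sum_mul, Finset.sum_sub_distrib]

section Generating

variable {ι : Type*} [Fintype ι] [DecidableEq ι]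

/-- The generating function `∑ₖ zᵏ Hⁿₖ(X) = ((1 + zP) X)ⁿ (1 + zP)`. -/
noncomputable def hpolyGen (P X : Matrix ι ι ℂ) (z : ℂ) (n : ℕ) : Matrix ι ι ℂ :=
  ((1 + z • P) * X) ^ n * (1 + z • P)

/-- Up to the trace, the gradient of `Tr (hpolyGen P X z (m + 1))` with respect to `X`. -/
noncomputable def hpolyGenGrad (P X : Matrix ι ι ℂ) (z : ℂ) (m : ℕ) : Matrix ι ι ℂ :=
  ∑ p ∈ Finset.HasAntidiagonal.antidiagonal m, hpolyGen P X z p.1 * hpolyGen P X z p.2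

lemma hpolyGen_zero (P X : Matrix ι ι ℂ) (z : ℂ) : hpolyGen P X z 0 = 1 + z • P := by
  simp [hpolyGen]

lemma hpolyGen_succ (P X : Matrix ι ι ℂ) (z : ℂ) (n : ℕ) :
    hpolyGen P X z (n + 1) = (1 + z • P) * X * hpolyGen P X z n := by
  simp only [hpolyGen, pow_succ', mul_assoc]

lemma hpolyGen_succ' (P X : Matrix ι ι ℂ) (z : ℂ) (n : ℕ) :
    hpolyGen P X z (n + 1) = hpolyGen P X z n * (X * (1 + z • P)) := by
  simp only [hpolyGen, pow_succ, mul_assoc]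

lemma sum_words_eq_hpolyGen (P X : Matrix ι ι ℂ) (z : ℂ) (n : ℕ) :
    ∑ c : Fin (n + 1) → Fin 2, z ^ (∑ j, (c j : ℕ)) •
      ((List.ofFn fun j : Fin n => P ^ (c j.castSucc : ℕ) * X).prod *
        P ^ (c (Fin.last n) : ℕ)) = hpolyGen P X z n := by
  induction n with
  | zero =>
    rw [hpolyGen_zero, ← (Equiv.funUnique (Fin 1) (Fin 2)).symm.sum_comp]
    simp [Fin.sum_univ_two]
  | succ n ih =>
    rw [← (Fin.consEquiv fun _ : Fin (n + 2) => Fin 2).sum_comp, Fintype.sum_prod_type,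
      hpolyGen_succ, ← ih, Finset.mul_sum, Fin.sum_univ_two, ← Finset.sum_add_distrib]
    refine Finset.sum_congr rfl fun c _ => ?_
    simp only [Fin.consEquiv, Equiv.coe_fn_mk, Fin.sum_univ_succ (n := n + 1), Fin.cons_zero,
      Fin.cons_succ, List.ofFn_succ, List.prod_cons, Fin.castSucc_zero, ← Fin.succ_last,
      ← Fin.succ_castSucc, pow_add]
    simp [add_mul, mul_assoc, mul_smul]
    exact smul_comm _ _ _

lemma sum_pow_smul_hpoly (P X : Matrix ι ι ℂ) (z : ℂ) (n : ℕ) :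
    ∑ k ∈ Finset.range (n + 2), z ^ k • Hpoly P X n k = hpolyGen P X z n := by
  rw [← sum_words_eq_hpolyGen, ← Finset.sum_fiberwise_of_maps_to
    (t := Finset.range (n + 2)) (g := fun c : Fin (n + 1) → Fin 2 => ∑ j, (c j : ℕ))]
  · refine Finset.sum_congr rfl fun k _ => ?_
    rw [Hpoly, Finset.smul_sum]
    refine Finset.sum_congr rfl fun c hc => ?_
    rw [(Finset.mem_filter.mp hc).2]
  · intro c _
    have : ∑ j, (c j : ℕ) ≤ ∑ _j : Fin (n + 1), 1 :=
      Finset.sum_le_sum fun j _ => by omega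
    simp at this
    simp
    omega

lemma smul_lie_hpolyGen {P : Matrix ι ι ℂ} (hP : P * P = P) (X : Matrix ι ι ℂ)
    (z : ℂ) (n : ℕ) :
    (1 + z) • ⁅X, hpolyGen P X z n⁆ = -(z • ⁅P, hpolyGen P X z (n + 1)⁆) := by
  have hl : ((1 + z) • 1 - z • P) * (1 + z • P) = (1 + z) • (1 : Matrix ι ι ℂ) := by
    simp only [sub_mul, mul_add, smul_mul_assoc, mul_smul_comm, one_mul, mul_one, hP]
    module
  have hr : (1 + z • P) * ((1 + z) • 1 - z • P) = (1 + z) • (1 : Matrix ι ι ℂ) := by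
    simp only [mul_sub, add_mul, smul_mul_assoc, mul_smul_comm, one_mul, mul_one, hP]
    module
  have h1 : ((1 + z) • 1 - z • P) * hpolyGen P X z (n + 1) =
      (1 + z) • (X * hpolyGen P X z n) := by
    rw [hpolyGen_succ, mul_assoc, ← mul_assoc, hl, smul_mul_assoc, one_mul]
  have h2 : hpolyGen P X z (n + 1) * ((1 + z) • 1 - z • P) =
      (1 + z) • (hpolyGen P X z n * X) := by
    rw [hpolyGen_succ', mul_assoc, mul_assoc, hr, mul_smul_comm, mul_smul_comm, mul_one]
  rw [Ring.lie_def, Ring.lie_def, smul_sub, ← h1, ← h2]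
  simp only [sub_mul, mul_sub, smul_mul_assoc, mul_smul_comm, one_mul, mul_one]
  module

lemma smul_lie_hpolyGenGrad {P : Matrix ι ι ℂ} (hP : P * P = P) (X : Matrix ι ι ℂ)
    (z : ℂ) (m : ℕ) :
    (1 + z) • ⁅X, hpolyGenGrad P X z m⁆ = -(z • ⁅P, hpolyGenGrad P X z (m + 1)⁆) := by
  have leibniz (A B C : Matrix ι ι ℂ) : ⁅A, B * C⁆ = ⁅A, B⁆ * C + B * ⁅A, C⁆ := by
    simp only [Ring.lie_def]; noncomm_ring
  have h0 : ⁅P, hpolyGen P X z 0⁆ = 0 := by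
    simp [hpolyGen_zero, Ring.lie_def, mul_add, add_mul]
  simp only [hpolyGenGrad, matrix_lie_sum, leibniz, Finset.sum_add_distrib]
  rw [Finset.Nat.sum_antidiagonal_succ (f := fun p => ⁅P, hpolyGen P X z p.1⁆ * hpolyGen P X z p.2),
    Finset.Nat.sum_antidiagonal_succ'
      (f := fun p => hpolyGen P X z p.1 * ⁅P, hpolyGen P X z p.2⁆)]
  simp only [h0, zero_mul, mul_zero, zero_add, smul_add, Finset.smul_sum, neg_add,
    ← Finset.sum_neg_distrib]
  congr 1 <;> refine Finset.sum_congr rfl fun p _ => ?_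
  · rw [← smul_mul_assoc, smul_lie_hpolyGen hP, neg_mul, smul_mul_assoc]
  · rw [← mul_smul_comm, smul_lie_hpolyGen hP, mul_neg, mul_smul_comm]

lemma trace_lie_hpolyGen_mul_grad {P : Matrix ι ι ℂ} (hP : P * P = P) (X : Matrix ι ι ℂ)
    {z w : ℂ} (hz : z ≠ -1) (hw : w ≠ 0) (n m : ℕ) :
    (⁅X, hpolyGen P X z n⁆ * hpolyGenGrad P X w m).trace = 0 := by
  have flip (A B C : Matrix ι ι ℂ) : (⁅A, B⁆ * C).trace = -(B * ⁅A, C⁆).trace := by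
    simp only [Ring.lie_def, sub_mul, mul_sub, trace_sub, ← mul_assoc]
    rw [mul_assoc A B C, trace_mul_comm A]
    ring
  have hz' : 1 + z ≠ 0 := fun h => hz (by linear_combination h)
  have key (n m : ℕ) (h : (hpolyGen P X z (n + 1) * ⁅P, hpolyGenGrad P X w m⁆).trace = 0) :
      (⁅X, hpolyGen P X z n⁆ * hpolyGenGrad P X w m).trace = 0 := by
    refine (mul_eq_zero.mp ?_).resolve_left hz'
    rw [← smul_eq_mul, ← trace_smul, ← smul_mul_assoc, smul_lie_hpolyGen hP, neg_mul,
      smul_mul_assoc, trace_neg, trace_smul, flip, h]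
    simp
  induction m generalizing n with
  | zero =>
    refine key n 0 ?_
    have : ⁅P, hpolyGenGrad P X w 0⁆ = 0 := by
      simp [hpolyGenGrad, hpolyGen_zero, Ring.lie_def, mul_add, add_mul, hP]
    simp [this]
  | succ m ih =>
    refine key n (m + 1) ((mul_eq_zero.mp ?_).resolve_left hw)
    have h : w • ⁅P, hpolyGenGrad P X w (m + 1)⁆ = -((1 + w) • ⁅X, hpolyGenGrad P X w m⁆) := by
      rw [smul_lie_hpolyGenGrad hP, neg_neg]
    rw [← smul_eq_mul, ← trace_smul, ← mul_smul_comm, h, mul_neg, mul_smul_comm, trace_neg,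
      trace_smul, ← smul_neg, ← flip, ih, smul_zero]

lemma trace_lie_hpoly_mul_grad {P : Matrix ι ι ℂ} (hP : P * P = P) (X : Matrix ι ι ℂ)
    {w : ℂ} (hw : w ≠ 0) {n k : ℕ} (hk : k ≤ n + 1) (m : ℕ) :
    (⁅X, Hpoly P X n k⁆ * hpolyGenGrad P X w m).trace = 0 := by
  refine eq_zero_of_sum_pow_mul_eq_zero (n + 2)
    (fun k => (⁅X, Hpoly P X n k⁆ * hpolyGenGrad P X w m).trace) (-1) (fun z hz => ?_)
    (Nat.lt_succ_of_le hk)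
  rw [← trace_lie_hpolyGen_mul_grad hP X hz hw n m, ← sum_pow_smul_hpoly, matrix_lie_sum,
    Finset.sum_mul, trace_sum]
  simp [Ring.lie_def, ← smul_sub]

end Generating

lemma hasDerivAt_matrix_mul_apply {ι : Type*} [Fintype ι] {A B : ℝ → Matrix ι ι ℂ}
    {A' B' : Matrix ι ι ℂ} {t : ℝ}
    (hA : ∀ p q, HasDerivAt (fun s => A s p q) (A' p q) t)
    (hB : ∀ p q, HasDerivAt (fun s => B s p q) (B' p q) t) (p q : ι) :
    HasDerivAt (fun s => (A s * B s) p q) ((A' * B t + A t * B') p q) t := by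
  simp only [Matrix.add_apply, Matrix.mul_apply, ← Finset.sum_add_distrib]
  exact HasDerivAt.fun_sum fun j _ => (hA p j).fun_mul (hB j q)

section Derivative

variable {ι : Type*} [Fintype ι] [DecidableEq ι]

lemma hasDerivAt_hpolyGen_apply (P : Matrix ι ι ℂ) (w : ℂ) {μ : ℝ → Matrix ι ι ℂ}
    {Y : Matrix ι ι ℂ} {t : ℝ} (hμ : ∀ p q, HasDerivAt (fun s => μ s p q) (Y p q) t) (m : ℕ)
    (p q : ι) :
    HasDerivAt (fun s => hpolyGen P (μ s) w (m + 1) p q)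
      ((∑ a ∈ Finset.HasAntidiagonal.antidiagonal m,
        hpolyGen P (μ t) w a.1 * Y * hpolyGen P (μ t) w a.2) p q) t := by
  have hconst (A : Matrix ι ι ℂ) (p q : ι) :
      HasDerivAt (fun _ : ℝ => A p q) ((0 : Matrix ι ι ℂ) p q) t := hasDerivAt_const _ _
  have hQ := hasDerivAt_matrix_mul_apply (hconst (1 + w • P)) hμ
  induction m generalizing p q with
  | zero =>
    simpa [hpolyGen_succ, hpolyGen_zero] using
      hasDerivAt_matrix_mul_apply hQ (hconst (1 + w • P)) p q
  | succ m ih =>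
    have h := hasDerivAt_matrix_mul_apply hQ ih p q
    simp only [← hpolyGen_succ] at h
    convert h using 2
    rw [Finset.Nat.sum_antidiagonal_succ]
    simp only [hpolyGen_zero, zero_mul, zero_add, Finset.mul_sum, hpolyGen_succ P (μ t) w _,
      mul_assoc]

lemma hasDerivAt_trace_hpolyGen (P : Matrix ι ι ℂ) (w : ℂ) {μ : ℝ → Matrix ι ι ℂ}
    {Y : Matrix ι ι ℂ} {t : ℝ} (hμ : ∀ p q, HasDerivAt (fun s => μ s p q) (Y p q) t) (m : ℕ) :
    HasDerivAt (fun s => (hpolyGen P (μ s) w (m + 1)).trace)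
      (Y * hpolyGenGrad P (μ t) w m).trace t := by
  have h : (Y * hpolyGenGrad P (μ t) w m).trace = (∑ a ∈ Finset.HasAntidiagonal.antidiagonal m,
      hpolyGen P (μ t) w a.1 * Y * hpolyGen P (μ t) w a.2).trace := by
    rw [hpolyGenGrad, Finset.mul_sum, trace_sum, trace_sum, ← Finset.Nat.sum_antidiagonal_swap]
    refine Finset.sum_congr rfl fun a _ => ?_
    rw [← mul_assoc, trace_mul_comm, ← mul_assoc]
    rfl
  rw [h]
  exact HasDerivAt.fun_sum fun p _ => hasDerivAt_hpolyGen_apply P w hμ m p p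

end Derivative

/-- along the Lax equation `μ′ = i^{n+1} [μ, H^n_k(μ)]`, all the traces
`Tr H^m_l(μ(t))` (`m ≥ 1`, `0 ≤ l ≤ m+1`) are integrals of motion. -/
theorem stmt_8 (N M : ℕ) (hN : 0 < N) (hM : 0 < M)
    (n k : ℕ) (hn : 1 ≤ n) (hk1 : 1 ≤ k) (hk2 : k ≤ n + 1)
    (μ : ℝ → Matrix (Fin N ⊕ Fin M) (Fin N ⊕ Fin M) ℂ)
    (hskew : ∀ t, (μ t)ᴴ = -μ t)
    (hlax : ∀ (t : ℝ) (p q : Fin N ⊕ Fin M),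
      HasDerivAt (fun s => μ s p q)
        ((Complex.I ^ (n + 1) •
          (μ t * Hpoly (Pplus N M) (μ t) n k - Hpoly (Pplus N M) (μ t) n k * μ t)) p q) t) :
    ∀ m l : ℕ, 1 ≤ m → l ≤ m + 1 →
      ∀ t, (Hpoly (Pplus N M) (μ t) m l).trace = (Hpoly (Pplus N M) (μ 0) m l).trace := by
  intro m l hm hl t
  have hP : Pplus N M * Pplus N M = Pplus N M := by
    simp [Pplus, fromBlocks_multiply]
  have hgen (w : ℂ) (hw : w ≠ 0) : (hpolyGen (Pplus N M) (μ t) w m).trace =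
      (hpolyGen (Pplus N M) (μ 0) w m).trace := by
    obtain ⟨m, rfl⟩ := Nat.exists_eq_add_of_le' hm
    have hd (s : ℝ) := hasDerivAt_trace_hpolyGen (Pplus N M) w (hlax s) m
    refine is_const_of_deriv_eq_zero (fun s => (hd s).differentiableAt) (fun s => ?_) t 0
    rw [(hd s).deriv, smul_mul_assoc, trace_smul, ← Ring.lie_def,
      trace_lie_hpoly_mul_grad hP (μ s) hw hk2, smul_zero]
  refine sub_eq_zero.mp (eq_zero_of_sum_pow_mul_eq_zero (m + 2)
    (fun l => (Hpoly (Pplus N M) (μ t) m l).trace - (Hpoly (Pplus N M) (μ 0) m l).trace) 0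
    (fun w hw => ?_) (Nat.lt_succ_of_le hl))
  have h := hgen w hw
  simp only [← sum_pow_smul_hpoly, trace_sum, trace_smul, smul_eq_mul] at h
  simp only [mul_sub, Finset.sum_sub_distrib, h, sub_self]
end

section
/- Let μ be a skew-Hermitian (N+M)×(N+M) complex matrix. Then for every n ≥ 1 and 0 ≤ k ≤ n+1 one has H^n_k(μ)* = (−1)^n H^n_k(μ), and consequently the matrix i^{n+1} [μ, H^n_k(μ)] is skew-Hermitian; i.e. the Lax vector field μ ↦ i^{n+1}[μ, H^n_k(μ)] preserves the real subspace of skew-Hermitian matrices. -/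
open Matrix Complex
open scoped ComplexOrder

/-- The adjoint of an alternating product `a₀ x a₁ x ⋯ x aₙ` with self-adjoint `aⱼ` and
skew-adjoint `x` is, up to the sign `(-1)^n`, the same product with the `aⱼ` reversed. -/
theorem star_alternating_prod {R : Type*} [Ring R] [StarRing R] {x : R} (hx : star x = -x)
    (n : ℕ) (a : Fin (n + 1) → R) (ha : ∀ j, star (a j) = a j) :
    star ((List.ofFn fun j : Fin n => a j.castSucc * x).prod * a (Fin.last n)) =
      (-1) ^ n * ((List.ofFn fun j : Fin n => a j.castSucc.rev * x).prod *
        a (Fin.last n).rev) := by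
  induction n with
  | zero => simp [ha]
  | succ n ih =>
    have hsucc := ih (fun j => a j.succ) fun j => ha _
    rw [List.ofFn_succ, List.prod_cons, mul_assoc, star_mul, star_mul (a _), ha, hx]
    simp only [← Fin.succ_castSucc, ← Fin.succ_last] at hsucc ⊢
    rw [hsucc, List.ofFn_succ', List.concat_eq_append, List.prod_append]
    simp only [Fin.rev_castSucc, Fin.rev_last, List.prod_singleton, Fin.rev_succ,
      Fin.castSucc_zero, pow_succ]
    noncomm_ring

theorem conjTranspose_Pplus (N M : ℕ) : (Pplus N M)ᴴ = Pplus N M := by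
  simp [Pplus, Matrix.fromBlocks_conjTranspose]

theorem conjTranspose_Hpoly {ι : Type*} [Fintype ι] [DecidableEq ι] {P X : Matrix ι ι ℂ}
    (hP : Pᴴ = P) (hX : Xᴴ = -X) (n k : ℕ) :
    (Hpoly P X n k)ᴴ = ((-1 : ℂ) ^ n) • Hpoly P X n k := by
  unfold Hpoly
  rw [Matrix.conjTranspose_sum, Finset.smul_sum]
  refine Finset.sum_equiv (Fin.revPerm.arrowCongr (Equiv.refl (Fin 2))) (fun c => ?_)
    fun c _ => ?_
  · have hsum : ∑ j, (c (Fin.rev j) : ℕ) = ∑ j, (c j : ℕ) :=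
      Equiv.sum_comp Fin.revPerm fun j => (c j : ℕ)
    simp [Equiv.arrowCongr, hsum]
  · have hword := star_alternating_prod (x := X) hX n (fun j => P ^ (c j : ℕ)) fun j => by
      rw [star_pow, Matrix.star_eq_conjTranspose, hP]
    rw [Matrix.star_eq_conjTranspose] at hword
    rw [hword]
    rcases Nat.even_or_odd n with h | h <;>
      simp [Equiv.arrowCongr, h.neg_one_pow]

/-- if `μ` is skew-Hermitian then `H^n_k(μ)* = (−1)^n H^n_k(μ)` for all
`n ≥ 1`, `0 ≤ k ≤ n+1`, and consequently `i^{n+1}[μ, H^n_k(μ)]` is skew-Hermitian. -/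
theorem stmt_10 (N M : ℕ) (hN : 0 < N) (hM : 0 < M)
    (μ : Matrix (Fin N ⊕ Fin M) (Fin N ⊕ Fin M) ℂ) (hμ : μᴴ = -μ) :
    ∀ n k : ℕ, 1 ≤ n → k ≤ n + 1 →
      (Hpoly (Pplus N M) μ n k)ᴴ = ((-1 : ℂ) ^ n) • Hpoly (Pplus N M) μ n k ∧
      (Complex.I ^ (n + 1) •
          (μ * Hpoly (Pplus N M) μ n k - Hpoly (Pplus N M) μ n k * μ))ᴴ =
        -(Complex.I ^ (n + 1) •
          (μ * Hpoly (Pplus N M) μ n k - Hpoly (Pplus N M) μ n k * μ)) := by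
  intro n k _ _
  have hH := conjTranspose_Hpoly (conjTranspose_Pplus N M) hμ n k
  refine ⟨hH, ?_⟩
  rw [Matrix.conjTranspose_smul, Matrix.conjTranspose_sub, Matrix.conjTranspose_mul,
    Matrix.conjTranspose_mul, hH, hμ, star_pow, Complex.star_def, Complex.conj_I,
    neg_pow, pow_succ (-1 : ℂ)]
  rcases Nat.even_or_odd n with h | h <;> simp [h.neg_one_pow, ← smul_neg, sub_eq_add_neg, add_comm]
end

section
/- For the block matrix μ = [[0, −B u*], [u B, D]] one has i⁴(μ H²₀(μ))₋₋ u = −D u B² − u B² u* D u + D³ u, where H²₀(μ) = μ². (This is the right-hand side of the equation of the hierarchy for the time t³₁: ∂u/∂t³₁ = −D u B² − u B² u* D u + D³ u.) -/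
open Matrix Complex
open scoped ComplexOrder

/-- For `k = 0` only the multi-index `0` contributes, so `H^n_0(X) = X ^ n`. -/
theorem Hpoly_zero_right {ι : Type*} [Fintype ι] [DecidableEq ι]
    (P X : Matrix ι ι ℂ) (n : ℕ) : Hpoly P X n 0 = X ^ n := by
  have hfilter : Finset.univ.filter
      (fun c : Fin (n + 1) → Fin 2 => (∑ j, (c j : ℕ)) = 0) = {0} := by
    ext c
    simp only [Finset.mem_filter, Finset.mem_univ, true_and, Finset.sum_eq_zero_iff,
      forall_const, Finset.mem_singleton, funext_iff, Pi.zero_apply, Fin.val_eq_zero_iff]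
  rw [Hpoly, hfilter]
  simp [List.ofFn_const]

/-- The lower right block of `μ³`. -/
theorem toBlocks₂₂_muBlock_mul_sq {N M : ℕ} (u : Matrix (Fin M) (Fin N) ℂ)
    (B : Matrix (Fin N) (Fin N) ℂ) (D : Matrix (Fin M) (Fin M) ℂ) :
    (muBlock u B D * muBlock u B D ^ 2).toBlocks₂₂ =
      -(u * B ^ 2 * uᴴ * D) - D * u * B ^ 2 * uᴴ + D ^ 3 := by
  simp only [muBlock, pow_succ, pow_zero, Matrix.one_mul, fromBlocks_multiply,
    toBlocks_fromBlocks₂₂, Matrix.mul_add, Matrix.mul_neg, Matrix.neg_mul,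
    Matrix.mul_assoc, Matrix.zero_mul, Matrix.mul_zero, zero_add]
  abel

/-- `H²₀(μ) = μ²` and the right-hand side of the `t³₁` equation:
`i⁴(μ H²₀(μ))₋₋ u = −D u B² − u B² u* D u + D³ u`. -/
theorem stmt_12 (N M : ℕ) (hN : 0 < N) (hM : 0 < M)
    (u : Matrix (Fin M) (Fin N) ℂ) (hu : u * uᴴ * u = u)
    (B : Matrix (Fin N) (Fin N) ℂ) (hB : B.PosSemidef) (hBu : B * (uᴴ * u) = B)
    (D : Matrix (Fin M) (Fin M) ℂ) (hD : Dᴴ = -D) :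
    Hpoly (Pplus N M) (muBlock u B D) 2 0 = muBlock u B D ^ 2 ∧
    Complex.I ^ 4 •
      ((muBlock u B D * Hpoly (Pplus N M) (muBlock u B D) 2 0).toBlocks₂₂ * u) =
      -(D * u * B ^ 2) - u * B ^ 2 * uᴴ * D * u + D ^ 3 * u := by
  rw [Hpoly_zero_right]
  refine ⟨rfl, ?_⟩
  have hB2 : B ^ 2 * (uᴴ * u) = B ^ 2 := by
    rw [pow_two, Matrix.mul_assoc, hBu]
  have hDuB : D * u * B ^ 2 * uᴴ * u = D * u * B ^ 2 := by
    rw [Matrix.mul_assoc _ uᴴ u, Matrix.mul_assoc _ (B ^ 2), hB2]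
  rw [toBlocks₂₂_muBlock_mul_sq, I_pow_four, one_smul, Matrix.add_mul, Matrix.sub_mul,
    Matrix.neg_mul, hDuB]
  abel
end

section
/- For the block matrix μ = [[0, −B u*], [u B, D]] one has i⁴(μ H²₁(μ))₋₋ u = −D u B² − u B² u* D u, where H²₁(μ) = P₊μμ + μP₊μ + μμP₊. (This is the right-hand side of the equation of the hierarchy for the time t³₂: ∂u/∂t³₂ = −D u B² − u B² u* D u.) -/
open Matrix Complex
open scoped ComplexOrder

/-- Expansion of `H²₁` into its three summands. -/
theorem Hpoly_two_one {ι : Type*} [Fintype ι] [DecidableEq ι] (P X : Matrix ι ι ℂ) :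
    Hpoly P X 2 1 = P * X * X + X * P * X + X * X * P := by
  have hfilter : Finset.univ.filter (fun c : Fin (2 + 1) → Fin 2 => (∑ j, (c j : ℕ)) = 1) =
      {![1, 0, 0], ![0, 1, 0], ![0, 0, 1]} := by
    decide
  rw [Hpoly, hfilter, Finset.sum_insert (by decide), Finset.sum_insert (by decide),
    Finset.sum_singleton]
  simp [List.ofFn_succ, Fin.last, mul_assoc, add_assoc]

/-- `H²₁(μ) = P₊μμ + μP₊μ + μμP₊` and the right-hand side of the `t³₂`
equation: `i⁴(μ H²₁(μ))₋₋ u = −D u B² − u B² u* D u`. -/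
theorem stmt_13 (N M : ℕ) (hN : 0 < N) (hM : 0 < M)
    (u : Matrix (Fin M) (Fin N) ℂ) (hu : u * uᴴ * u = u)
    (B : Matrix (Fin N) (Fin N) ℂ) (hB : B.PosSemidef) (hBu : B * (uᴴ * u) = B)
    (D : Matrix (Fin M) (Fin M) ℂ) (hD : Dᴴ = -D) :
    Hpoly (Pplus N M) (muBlock u B D) 2 1 =
      Pplus N M * muBlock u B D * muBlock u B D +
      muBlock u B D * Pplus N M * muBlock u B D +
      muBlock u B D * muBlock u B D * Pplus N M ∧
    Complex.I ^ 4 •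
      ((muBlock u B D * Hpoly (Pplus N M) (muBlock u B D) 2 1).toBlocks₂₂ * u) =
      -(D * u * B ^ 2) - u * B ^ 2 * uᴴ * D * u := by
  refine ⟨Hpoly_two_one _ _, ?_⟩
  have hBBu : B * (B * (uᴴ * u)) = B * B := by rw [hBu]
  rw [Hpoly_two_one, Complex.I_pow_four, one_smul]
  simp only [Pplus, muBlock, fromBlocks_multiply, fromBlocks_add, toBlocks_fromBlocks₂₂]
  simp only [Matrix.mul_zero, Matrix.zero_mul, Matrix.one_mul, Matrix.mul_one, add_zero,
    zero_add, neg_zero, Matrix.mul_neg, Matrix.neg_mul, Matrix.add_mul, Matrix.mul_assoc,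
    pow_two, hBBu]
  abel
end

section
/- For the block matrix μ = [[0, −B u*], [u B, D]] one has i⁵(μ H³₁(μ))₋₋ u = i(2 u B⁴ − D² u B² − u B² u* D² u − D u B² u* D u), where H³₁(μ) = P₊μμμ + μP₊μμ + μμP₊μ + μμμP₊. (This is the right-hand side of the equation of the hierarchy for the time t⁴₂.) -/
open Matrix Complex
open scoped ComplexOrder

/-- The degree-one polynomial `H³₁` is the sum over the four positions of the projector. -/
theorem Hpoly_three_one {ι : Type*} [Fintype ι] [DecidableEq ι] (P X : Matrix ι ι ℂ) :
    Hpoly P X 3 1 = P * X * X * X + X * P * X * X + X * X * P * X + X * X * X * P := by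
  have hfilter : Finset.univ.filter
      (fun c : Fin (3 + 1) → Fin 2 => (∑ j, (c j : ℕ)) = 1) =
      {![1, 0, 0, 0], ![0, 1, 0, 0], ![0, 0, 1, 0], ![0, 0, 0, 1]} := by
    decide
  rw [Hpoly, hfilter, Finset.sum_insert (by decide), Finset.sum_insert (by decide),
    Finset.sum_insert (by decide), Finset.sum_singleton]
  simp [List.ofFn_succ, Fin.last, Matrix.mul_assoc, add_assoc]

/-- `H³₁(μ) = P₊μμμ + μP₊μμ + μμP₊μ + μμμP₊` and the right-hand side of the
`t⁴₂` equation: `i⁵(μ H³₁(μ))₋₋ u = i(2 u B⁴ − D² u B² − u B² u* D² u − D u B² u* D u)`. -/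
theorem stmt_14 (N M : ℕ) (hN : 0 < N) (hM : 0 < M)
    (u : Matrix (Fin M) (Fin N) ℂ) (hu : u * uᴴ * u = u)
    (B : Matrix (Fin N) (Fin N) ℂ) (hB : B.PosSemidef) (hBu : B * (uᴴ * u) = B)
    (D : Matrix (Fin M) (Fin M) ℂ) (hD : Dᴴ = -D) :
    Hpoly (Pplus N M) (muBlock u B D) 3 1 =
      Pplus N M * muBlock u B D * muBlock u B D * muBlock u B D +
      muBlock u B D * Pplus N M * muBlock u B D * muBlock u B D +
      muBlock u B D * muBlock u B D * Pplus N M * muBlock u B D +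
      muBlock u B D * muBlock u B D * muBlock u B D * Pplus N M ∧
    Complex.I ^ 5 •
      ((muBlock u B D * Hpoly (Pplus N M) (muBlock u B D) 3 1).toBlocks₂₂ * u) =
      Complex.I • ((2 : ℂ) • (u * B ^ 4) - D ^ 2 * u * B ^ 2
        - u * B ^ 2 * uᴴ * D ^ 2 * u - D * u * B ^ 2 * uᴴ * D * u) := by
  refine ⟨Hpoly_three_one _ _, ?_⟩
  have hBu_assoc {l : ℕ} (Y : Matrix (Fin N) (Fin l) ℂ) : B * (uᴴ * (u * Y)) = B * Y := by
    rw [← Matrix.mul_assoc uᴴ, ← Matrix.mul_assoc B, hBu]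
  have hI : Complex.I ^ 5 = Complex.I := by
    rw [pow_succ, Complex.I_pow_four, one_mul]
  rw [Hpoly_three_one, hI]
  congr 1
  simp only [Pplus, muBlock, fromBlocks_multiply, fromBlocks_add, toBlocks_fromBlocks₂₂,
    pow_succ, pow_zero, Matrix.one_mul, Matrix.mul_assoc, Matrix.mul_add, Matrix.add_mul,
    Matrix.mul_neg, Matrix.neg_mul, Matrix.mul_zero, Matrix.zero_mul, Matrix.mul_one,
    hBu, hBu_assoc, two_smul, neg_neg, neg_zero, add_zero, zero_add]
  abel
end
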